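/- Let k be an algebraic extension of 𝔽_p and let Γ be a subgroup of ℚ with ℤ ⊆ Γ ⊆ ℚ. Then there exists α ∈ ℂ_p, transcendental over ℚ, such that the valuation ring ℤ_{(p),α} of ℚ(X) has residue field isomorphic to k and value group equal to Γ. -/

import Mathlib

open Polynomial Filter

noncomputable section

/-- An additive `ℚ`-valued valuation on a field `K` (written additively, with `v 0 = ⊤`). -/
structure AddVal (K : Type) [Field K] where
  v : K → WithTop ℚ
  v_eq_top_iff : ∀ x : K, v x = ⊤ ↔ x = 0
  v_mul : ∀ x y : K, v (x * y) = v x + v y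
  min_le_v_add : ∀ x y : K, min (v x) (v y) ≤ v (x + y)

namespace AddVal

variable {K : Type} [Field K] (w : AddVal K)

/-- A Cauchy sequence with respect to an additive valuation. -/
def IsCauchySeq (s : ℕ → K) : Prop :=
  ∀ γ : ℚ, ∃ N : ℕ, ∀ m ≥ N, ∀ n ≥ N, (γ : WithTop ℚ) < w.v (s m - s n)

/-- Convergence of a sequence to a limit, with respect to an additive valuation. -/
def TendsToVal (s : ℕ → K) (l : K) : Prop :=
  ∀ γ : ℚ, ∃ N : ℕ, ∀ n ≥ N, (γ : WithTop ℚ) < w.v (s n - l)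

/-- A pseudo-convergent sequence: `v (s n - s m) < v (s m - s k)` for `n < m < k`. -/
def IsPseudoConvergent (s : ℕ → K) : Prop :=
  ∀ ⦃n m k : ℕ⦄, n < m → m < k → w.v (s n - s m) < w.v (s m - s k)

/-- A sequence is of transcendental type over a subring (mapped in via `g`) if for every
polynomial `f` over that ring the sequence `v (f (s n))` is eventually constant. -/
def IsTranscendentalTypeOver {R : Type} [CommRing R] (g : R →+* K) (s : ℕ → K) : Prop :=
  ∀ f : Polynomial R, ∃ N : ℕ, ∀ m ≥ N, ∀ n ≥ N,
    w.v (f.eval₂ g (s m)) = w.v (f.eval₂ g (s n))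

/-- A sequence of transcendental type: for every polynomial `f ∈ K[X]`, `v (f (s n))` is
eventually constant. -/
def IsTranscendentalType (s : ℕ → K) : Prop :=
  w.IsTranscendentalTypeOver (RingHom.id K) s

/-- `α` is a pseudo-limit of `s` when `v (s n - α)` is strictly increasing. -/
def IsPseudoLimit (s : ℕ → K) (α : K) : Prop :=
  StrictMono fun n => w.v (s n - α)

/-- The breadth ideal of a pseudo-convergent sequence. -/
def breadth (s : ℕ → K) : Set K :=
  {x : K | ∀ n : ℕ, w.v (s (n + 1) - s n) < w.v x}

/-- Equivalence of pseudo-convergent sequences. -/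
def SeqEquiv (s t : ℕ → K) : Prop :=
  w.breadth s = w.breadth t ∧
    ∀ k : ℕ, ∃ i₀ j₀ : ℕ, ∀ i ≥ i₀, ∀ j ≥ j₀, w.v (s (k + 1) - s k) < w.v (s i - t j)

end AddVal

/-- `α` is transcendental over the image of `g`. -/
def IsTranscOver {R K : Type} [CommRing R] [Field K] (g : R →+* K) (α : K) : Prop :=
  ∀ f : Polynomial R, f ≠ 0 → f.eval₂ g α ≠ 0
/-- A fixed algebraic closure of `ℚ_p`. -/
abbrev Qpbar (p : ℕ) [Fact p.Prime] : Type := AlgebraicClosure ℚ_[p]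

/-- The unique extension of the `p`-adic valuation to the algebraic closure of `ℚ_p`,
presented as an additive `ℚ`-valued valuation extending `Padic.valuation`. -/
structure PadicSetup (p : ℕ) [Fact p.Prime] where
  vbar : AddVal (Qpbar p)
  vbar_extends : ∀ x : ℚ_[p], x ≠ 0 →
    vbar.v (algebraMap ℚ_[p] (Qpbar p) x) = ((x.valuation : ℚ) : WithTop ℚ)

/-- A model of `ℂ_p`: a complete valued field in which `Q̄_p` embeds isometrically
and densely. -/
structure CpSetup (p : ℕ) [Fact p.Prime] extends PadicSetup p where
  Cp : Type
  [fieldCp : Field Cp]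
  emb : Qpbar p →+* Cp
  vC : AddVal Cp
  vC_emb : ∀ x : Qpbar p, vC.v (emb x) = vbar.v x
  complete : ∀ s : ℕ → Cp, vC.IsCauchySeq s → ∃ l : Cp, vC.TendsToVal s l
  dense : ∀ y : Cp, ∃ s : ℕ → Qpbar p, vC.TendsToVal (fun n => emb (s n)) y

attribute [instance] CpSetup.fieldCp

variable (p : ℕ) [Fact p.Prime]

/-- The degree `[ℚ_p(x) : ℚ_p]` of an element of the algebraic closure of `ℚ_p`. -/
def degOf (x : Qpbar p) : ℕ :=
  Module.finrank ℚ_[p] ↥(IntermediateField.adjoin ℚ_[p] {x})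

/-- A stacked sequence in `Q̄_p`: `s 0 ∈ ℚ_p`, the degrees `[ℚ_p(s n) : ℚ_p]` are strictly
increasing, and each `(s n, v (s (n+1) - s n))` is a minimal pair. -/
structure IsStacked (S : PadicSetup p) (s : ℕ → Qpbar p) : Prop where
  first : ∃ c : ℚ_[p], s 0 = algebraMap ℚ_[p] (Qpbar p) c
  deg_lt : ∀ n : ℕ, degOf p (s n) < degOf p (s (n + 1))
  min_pair : ∀ n : ℕ, ∀ c : Qpbar p, degOf p c < degOf p (s n) →
    S.vbar.v (s n - c) < S.vbar.v (s (n + 1) - s n)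

/-- A strongly stacked sequence: moreover each pair `(s n, s (n+1))` is distinguished. -/
structure IsStronglyStacked (S : PadicSetup p) (s : ℕ → Qpbar p) extends
    IsStacked p S s : Prop where
  dist : ∀ n : ℕ, ∀ c : Qpbar p, degOf p c < degOf p (s (n + 1)) →
    S.vbar.v (s (n + 1) - c) ≤ S.vbar.v (s (n + 1) - s n)

/-- The canonical map `ℚ → Q̄_p`. -/
def qHomQpbar : ℚ →+* Qpbar p :=
  (algebraMap ℚ_[p] (Qpbar p)).comp (Rat.castHom ℚ_[p])

/-- The ring `ℤ_{p,E}` (as a subset of `ℚ_p(X)`) attached to a sequence `E ⊆ Q̄_p`: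
rational functions mapping almost all the `s n` into `Z̄_p`. -/
def ZpE (S : PadicSetup p) (s : ℕ → Qpbar p) : Set (RatFunc ℚ_[p]) :=
  {φ : RatFunc ℚ_[p] | ∀ᶠ n in atTop,
    φ.denom.eval₂ (algebraMap ℚ_[p] (Qpbar p)) (s n) ≠ 0 ∧
      0 ≤ S.vbar.v (φ.eval (algebraMap ℚ_[p] (Qpbar p)) (s n))}

/-- The ring `ℤ_{(p),E}` (as a subset of `ℚ(X)`) attached to a sequence `E ⊆ Q̄_p`. -/
def ZplE (S : PadicSetup p) (s : ℕ → Qpbar p) : Set (RatFunc ℚ) :=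
  {φ : RatFunc ℚ | ∀ᶠ n in atTop,
    φ.denom.eval₂ (qHomQpbar p) (s n) ≠ 0 ∧
      0 ≤ S.vbar.v (φ.eval (qHomQpbar p) (s n))}

/-- `W` is a residually algebraic torsion extension of `ℤ_p` to `ℚ_p(X)`:
`W ∩ ℚ_p = ℤ_p`, the residue field of `W` is algebraic over `𝔽_p`, and the value group of `W`
is contained in the divisible hull of the value group of `ℤ_p`. -/
def IsResAlgTorsionQp (W : ValuationSubring (RatFunc ℚ_[p])) : Prop :=
  (∀ c : ℚ_[p], RatFunc.C c ∈ W ↔ ‖c‖ ≤ 1) ∧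
  (∀ x : IsLocalRing.ResidueField W, ∃ k : ℕ, 1 ≤ k ∧ x ^ p ^ k = x) ∧
  (∀ φ : RatFunc ℚ_[p], φ ≠ 0 → ∃ n : ℕ, 1 ≤ n ∧ ∃ c : ℚ_[p], c ≠ 0 ∧
    φ ^ n / RatFunc.C c ∈ W ∧ RatFunc.C c / φ ^ n ∈ W)

/-- `W` is a residually algebraic torsion extension of `ℤ_(p)` to `ℚ(X)`. -/
def IsResAlgTorsionQ (W : ValuationSubring (RatFunc ℚ)) : Prop :=
  (∀ c : ℚ, RatFunc.C c ∈ W ↔ ‖(c : ℚ_[p])‖ ≤ 1) ∧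
  (∀ x : IsLocalRing.ResidueField W, ∃ k : ℕ, 1 ≤ k ∧ x ^ p ^ k = x) ∧
  (∀ φ : RatFunc ℚ, φ ≠ 0 → ∃ n : ℕ, 1 ≤ n ∧ ∃ c : ℚ, c ≠ 0 ∧
    φ ^ n / RatFunc.C c ∈ W ∧ RatFunc.C c / φ ^ n ∈ W)

/-- The set of (rational) values of the valuation on an intermediate field of `Q̄_p/ℚ_p`. -/
def valSetF (S : PadicSetup p) (F : IntermediateField ℚ_[p] (Qpbar p)) : Set ℚ :=
  {γ : ℚ | ∃ a ∈ F, S.vbar.v a = (γ : WithTop ℚ)}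

/-- The value group (as a set of rationals) of `ℚ_p(x)` for `x ∈ Q̄_p`. -/
def valSetElem (S : PadicSetup p) (x : Qpbar p) : Set ℚ :=
  valSetF p S (IntermediateField.adjoin ℚ_[p] {x})

/-- The residue field of `F` is contained in the residue field of `F'` (inside the residue
field of `Z̄_p`). -/
def resSub (S : PadicSetup p) (F F' : IntermediateField ℚ_[p] (Qpbar p)) : Prop :=
  ∀ a ∈ F, 0 ≤ S.vbar.v a → ∃ b ∈ F', 0 ≤ S.vbar.v b ∧ 0 < S.vbar.v (a - b)

/-- A subset `Γ ⊆ ℚ` (a value group) has bounded denominators, i.e. finite ramification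
over `ℤ`. -/
def HasFiniteRamification (Γ : Set ℚ) : Prop :=
  ∃ e : ℕ, 0 < e ∧ ∀ γ ∈ Γ, ∃ k : ℤ, (e : ℚ) * γ = (k : ℚ)

/-- The ramification index of `Γ₁` over `Γ₀`: the least positive integer `e` with
`e • Γ₁ ⊆ Γ₀` (for the value groups of finite extensions of `ℚ_p` this is the index
`[Γ₁ : Γ₀]`). -/
def ramIdx (Γ₀ Γ₁ : Set ℚ) : ℕ :=
  sInf {e : ℕ | 0 < e ∧ ∀ γ ∈ Γ₁, (e : ℚ) * γ ∈ Γ₀}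

/-- The value group of `ℚ_p` (normalized): the integers, as a subset of `ℚ`. -/
def zSet : Set ℚ := Set.range ((↑) : ℤ → ℚ)

/-- The maximal unramified extension of a finite extension `K` of `ℚ_p` inside `Q̄_p`:
the set of `x` with `K(x)/K` unramified. -/
def maxUnramified (S : PadicSetup p) (K : IntermediateField ℚ_[p] (Qpbar p)) :
    Set (Qpbar p) :=
  {x : Qpbar p | valSetF p S (K ⊔ IntermediateField.adjoin ℚ_[p] {x}) = valSetF p S K}

section CpDefs

variable (S : CpSetup p)

/-- The canonical map `ℚ_p → ℂ_p`. -/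
def qpHomC : ℚ_[p] →+* S.Cp :=
  S.emb.comp (algebraMap ℚ_[p] (Qpbar p))

/-- The canonical map `ℚ → ℂ_p`. -/
def qHomC : ℚ →+* S.Cp :=
  (qpHomC p S).comp (Rat.castHom ℚ_[p])

/-- The valuation domain `ℤ_{p,α} = {φ ∈ ℚ_p(X) : φ(α) ∈ O_p}` (as a subset of `ℚ_p(X)`). -/
def Zpa (α : S.Cp) : Set (RatFunc ℚ_[p]) :=
  {φ : RatFunc ℚ_[p] | φ.denom.eval₂ (qpHomC p S) α ≠ 0 ∧
    0 ≤ S.vC.v (φ.eval (qpHomC p S) α)}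

/-- The valuation domain `ℤ_{(p),α} = {φ ∈ ℚ(X) : φ(α) ∈ O_p}` (as a subset of `ℚ(X)`). -/
def Zpla (α : S.Cp) : Set (RatFunc ℚ) :=
  {φ : RatFunc ℚ | φ.denom.eval₂ (qHomC p S) α ≠ 0 ∧
    0 ≤ S.vC.v (φ.eval (qHomC p S) α)}

/-- Membership in the subfield `ℚ_p(α)` of `ℂ_p`. -/
def InQpAlpha (α x : S.Cp) : Prop :=
  ∃ f g : Polynomial ℚ_[p], g.eval₂ (qpHomC p S) α ≠ 0 ∧
    x = f.eval₂ (qpHomC p S) α / g.eval₂ (qpHomC p S) α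

/-- The value group `Γ_α ⊆ ℚ` of `ℚ_p(α) ⊆ ℂ_p`. -/
def valSetCp (α : S.Cp) : Set ℚ :=
  {γ : ℚ | ∃ x : S.Cp, InQpAlpha p S α x ∧ S.vC.v x = (γ : WithTop ℚ)}

/-- The residue field `k_α` of `O_{p,α} = O_p ∩ ℚ_p(α)` is finite. -/
def ResFieldFiniteCp (α : S.Cp) : Prop :=
  ∃ T : Finset S.Cp, ∀ x : S.Cp, InQpAlpha p S α x → 0 ≤ S.vC.v x →
    ∃ a ∈ T, 0 < S.vC.v (x - a)

/-- `α` and `β` are conjugate over `ℚ_p`: some element of `Gal(Q̄_p/ℚ_p)`, extended to its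
unique continuous (equivalently, isometric) automorphism of `ℂ_p`, maps `α` to `β`. -/
def ConjCp (α β : S.Cp) : Prop :=
  ∃ σ : S.Cp →+* S.Cp, (∀ c : ℚ_[p], σ (qpHomC p S c) = qpHomC p S c) ∧
    (∀ x : Qpbar p, ∃ y : Qpbar p, σ (S.emb x) = S.emb y) ∧
    (∀ x : S.Cp, S.vC.v (σ x) = S.vC.v x) ∧ σ α = β

end CpDefs



/-- The field `k` (of characteristic `p`) contains an element of degree exactly `d` over
`𝔽_p`; by Steinitz's classification, two algebraic extensions of `𝔽_p` are isomorphic iff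
they contain elements of exactly the same degrees. -/
def FieldHasDeg (p d : ℕ) (k : Type) [Field k] : Prop :=
  ∃ x : k, x ^ p ^ d = x ∧ ∀ e : ℕ, 1 ≤ e → e < d → x ^ p ^ e ≠ x

/-- The residue field of the valuation ring `ℤ_{(p),α}` of `ℚ(X)` contains an element of
degree exactly `d` over `𝔽_p`. -/
def ZplaResHasDeg (p : ℕ) [Fact p.Prime] (S : CpSetup p) (α : S.Cp) (d : ℕ) : Prop :=
  ∃ φ ∈ Zpla p S α,
    0 < S.vC.v ((RatFunc.eval (qHomC p S) α φ) ^ p ^ d - RatFunc.eval (qHomC p S) α φ) ∧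
    ∀ e : ℕ, 1 ≤ e → e < d →
      ¬ 0 < S.vC.v ((RatFunc.eval (qHomC p S) α φ) ^ p ^ e - RatFunc.eval (qHomC p S) α φ)

theorem exists_residue_subring {L : Type} [Field L] [IsAlgClosed L]
    (w : AddValuation L (WithTop ℚ)) {p : ℕ} (hprime : p.Prime) (hp : 0 < w (p : L))
    (k : Type) [Field k] (hchar : (p : k) = 0)
    (halg : ∀ x : k, ∃ m : ℕ, 1 ≤ m ∧ x ^ p ^ m = x) :
    ∃ B : Subring L, (∀ x ∈ B, 0 ≤ w x) ∧ (∀ x, 0 < w x → x ∈ B) ∧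
      (∀ x ∈ B, ∃ y : k, ∀ e : ℕ, 0 < w (x ^ p ^ e - x) ↔ y ^ p ^ e = y) ∧
      (∀ y : k, ∃ x ∈ B, ∀ e : ℕ, 0 < w (x ^ p ^ e - x) ↔ y ^ p ^ e = y) := by
  let V : ValuationSubring L := w.toValuation.valuationSubring
  have hV : ∀ x, x ∈ V ↔ 0 ≤ w x := fun x => Iff.rfl
  let ρ : V →+* IsLocalRing.ResidueField V := IsLocalRing.residue V
  have hρ : ∀ x : V, ρ x = 0 ↔ 0 < w (x : L) := by
    intro x
    rw [IsLocalRing.residue_eq_zero_iff]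
    exact (w.toValuation.valuationSubring).valuation_lt_one_iff x |>.trans
      ((Valuation.isEquiv_valuation_valuationSubring w.toValuation).lt_one_iff_lt_one).symm
  have : Fact p.Prime := ⟨hprime⟩
  have hκ : CharP (IsLocalRing.ResidueField V) p := by
    refine (CharP.charP_iff_prime_eq_zero hprime).2 ?_
    have : ρ (p : V) = 0 := (hρ _).2 (by simpa using hp)
    simpa using this
  have hk : CharP k p := (CharP.charP_iff_prime_eq_zero hprime).2 hchar
  let _ : Algebra (ZMod p) k := ZMod.algebra k p
  let _ : Algebra (ZMod p) (IsLocalRing.ResidueField V) := ZMod.algebra _ p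
  have hkalg : Algebra.IsAlgebraic (ZMod p) k := by
    refine ⟨fun x => ?_⟩
    obtain ⟨m, hm, hx⟩ := halg x
    refine ⟨X ^ p ^ m - X, FiniteField.X_pow_card_pow_sub_X_ne_zero _ (by omega) hprime.one_lt, ?_⟩
    simp [hx]
  have hclosed : IsAlgClosed (IsLocalRing.ResidueField V) := by
    refine IsAlgClosed.of_exists_root _ fun f hf hirr => ?_
    have hl : f ∈ Polynomial.lifts ρ := by
      rw [Polynomial.mem_lifts]
      exact Polynomial.map_surjective ρ IsLocalRing.residue_surjective f
    obtain ⟨g, hgf, hdeg, hg⟩ := Polynomial.lifts_and_natDegree_eq_and_monic hl hf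
    obtain ⟨θ, hθ⟩ := IsAlgClosed.exists_root (g.map (algebraMap V L)) (by
      rw [hg.degree_map]
      have := hirr.degree_pos
      rw [Polynomial.degree_eq_natDegree hg.ne_zero, hdeg, ← Polynomial.degree_eq_natDegree hf.ne_zero]
      exact this.ne')
    have hint : IsIntegral V θ := ⟨g, hg, by rwa [IsRoot.def, eval_map] at hθ⟩
    obtain ⟨t, rfl⟩ := IsIntegrallyClosed.isIntegral_iff.1 hint
    refine ⟨ρ t, ?_⟩
    rw [IsRoot.def, eval_map, eval₂_at_apply] at hθ
    have h0 : g.eval t = 0 := Subtype.val_injective hθ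
    rw [← hgf, eval_map, eval₂_at_apply, h0, map_zero]
  let ι : k →ₐ[ZMod p] IsLocalRing.ResidueField V := IsAlgClosed.lift
  have key : ∀ (x : V) (y : k), ι y = ρ x →
      ∀ e : ℕ, 0 < w ((x : L) ^ p ^ e - x) ↔ y ^ p ^ e = y := by
    intro x y hxy e
    have h1 := hρ (x ^ p ^ e - x)
    have h2 : ρ (x ^ p ^ e - x) = ι (y ^ p ^ e - y) := by simp [hxy]
    rw [h2, map_eq_zero, sub_eq_zero] at h1
    rw [h1]
    simp
  refine ⟨(ι.toRingHom.range.comap ρ).map V.subtype, ?_, ?_, ?_, ?_⟩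
  · rintro _ ⟨x, -, rfl⟩
    exact (hV _).1 x.2
  · intro x hx
    refine ⟨⟨x, (hV x).2 hx.le⟩, ⟨0, ?_⟩, rfl⟩
    rw [map_zero]
    exact ((hρ ⟨x, _⟩).2 hx).symm
  · rintro _ ⟨x, ⟨y, hy⟩, rfl⟩
    exact ⟨y, key x y hy⟩
  · intro y
    obtain ⟨x, hx⟩ := IsLocalRing.residue_surjective (R := V) (ι y)
    exact ⟨x, ⟨x, ⟨y, hx.symm⟩, rfl⟩, key x y hx.symm⟩

theorem AddValuation.exists_map_sum_eq {L ι : Type*} [Field L] (w : AddValuation L (WithTop ℚ))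
    (s : Finset ι) (f : ι → L)
    (hd : ∀ i ∈ s, ∀ j ∈ s, f i ≠ 0 → w (f i) = w (f j) → i = j) (hne : ∃ i ∈ s, f i ≠ 0) :
    ∃ i ∈ s, f i ≠ 0 ∧ w (∑ j ∈ s, f j) = w (f i) ∧ ∀ j ∈ s, w (f i) ≤ w (f j) := by
  classical
  obtain ⟨i₀, hi₀, h0⟩ := hne
  obtain ⟨i, hi, hmin⟩ := s.exists_min_image (fun i => w (f i)) ⟨i₀, hi₀⟩
  have hne : w (f i) ≠ ⊤ := ne_top_of_le_ne_top ((w.ne_top_iff).2 h0) (hmin i₀ hi₀)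
  have hfi : f i ≠ 0 := (w.ne_top_iff).1 hne
  refine ⟨i, hi, hfi, ?_, hmin⟩
  rw [← Finset.add_sum_erase s f hi]
  refine w.map_add_eq_of_lt_left (w.map_lt_sum hne fun j hj => ?_)
  rw [Finset.mem_erase] at hj
  exact lt_of_le_of_ne (hmin j hj.2) fun h => hj.1 (hd i hi j hj.2 hfi h).symm

theorem Subfield.exists_adjoin_root {L : Type*} [Field L] (K : Subfield L) (θ : L) (f : K[X])
    (hf : f.Monic) (hθ : aeval θ f = 0) (Q : L → Prop)
    (h : ∀ g : K[X], g.degree < f.degree → Q (aeval θ g)) :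
    ∃ K' : Subfield L, K ≤ K' ∧ θ ∈ K' ∧ ∀ x ∈ K', Q x := by
  have hint : IsIntegral K θ := ⟨f, hf, hθ⟩
  refine ⟨(IntermediateField.adjoin K {θ}).toSubfield, fun x hx => ?_, ?_, fun x hx => ?_⟩
  · exact (IntermediateField.adjoin K {θ}).algebraMap_mem ⟨x, hx⟩
  · exact IntermediateField.mem_adjoin_simple_self K θ
  · have hx' : x ∈ IntermediateField.adjoin K {θ} := hx
    rw [← IntermediateField.mem_toSubalgebra,
      IntermediateField.adjoin_simple_toSubalgebra_of_isAlgebraic hint.isAlgebraic,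
      Algebra.adjoin_singleton_eq_range_aeval] at hx'
    obtain ⟨g, rfl⟩ := hx'
    have := h (g %ₘ f) (degree_modByMonic_lt _ hf)
    rwa [aeval_modByMonic_eq_self_of_root hθ] at this

/-- The values of the elements of `K` lie in `Γ`, and the integral elements of `K` lie in `B`. -/
def IsBoundedBy {L : Type*} [Field L] (w : AddValuation L (WithTop ℚ)) (Γ : AddSubgroup ℚ)
    (B : Subring L) (K : Subfield L) : Prop :=
  ∀ x ∈ K, (x ≠ 0 → ∃ γ ∈ Γ, w x = (γ : ℚ)) ∧ (0 ≤ w x → x ∈ B)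

theorem IsBoundedBy.exists_value {L : Type*} [Field L] [IsAlgClosed L]
    {w : AddValuation L (WithTop ℚ)} {Γ : AddSubgroup ℚ} {B : Subring L} {K : Subfield L}
    (hK : IsBoundedBy w Γ B K) (hB : ∀ x, 0 < w x → x ∈ B)
    (hZ : ∀ n : ℤ, ∃ x ∈ K, w x = ((n : ℚ) : WithTop ℚ)) {γ : ℚ} (hγ : γ ∈ Γ) :
    ∃ K' : Subfield L, K ≤ K' ∧ IsBoundedBy w Γ B K' ∧ ∃ x ∈ K', w x = (γ : ℚ) := by
  classical
  have hex : ∃ n : ℕ, 0 < n ∧ ∃ c ∈ K, w c = ((n * γ : ℚ) : WithTop ℚ) := by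
    refine ⟨γ.den, γ.den_pos, ?_⟩
    obtain ⟨c, hc, hw⟩ := hZ γ.num
    exact ⟨c, hc, by rw [hw, mul_comm, Rat.mul_den_eq_num]⟩
  obtain ⟨hn, c, hc, hwc⟩ := Nat.find_spec hex
  have hmin : ∀ m : ℕ, 0 < m → m < Nat.find hex → ∀ c ∈ K, w c ≠ ((m * γ : ℚ) : WithTop ℚ) :=
    fun m hm hlt c hc h => Nat.find_min hex hlt ⟨hm, c, hc, h⟩
  set n := Nat.find hex
  obtain ⟨θ, hθ⟩ := IsAlgClosed.exists_pow_nat_eq c hn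
  have hwθ : w θ = (γ : ℚ) := by
    have h1 : n • w θ = ((n * γ : ℚ) : WithTop ℚ) := by rw [← w.map_pow, hθ, hwc]
    have h2 : w θ ≠ ⊤ := by
      rintro h
      have h3 : θ = 0 := w.top_iff.1 h
      rw [← w.map_pow, h3, zero_pow hn.ne', w.map_zero] at h1
      exact WithTop.coe_ne_top h1.symm
    lift w θ to ℚ using h2 with t
    norm_cast at h1 ⊢
    rw [nsmul_eq_mul] at h1
    exact mul_left_cancel₀ (by exact_mod_cast hn.ne') h1
  have hterm : ∀ (i : ℕ) (b : L) (β : ℚ), w b = (β : ℚ) →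
      w (b * θ ^ i) = ((β + i * γ : ℚ) : WithTop ℚ) := by
    intro i b β hb
    rw [w.map_mul, w.map_pow, hwθ, hb]
    norm_cast
  have hmap : ∀ x : K, algebraMap K L x = x := fun _ => rfl
  obtain ⟨K', hKK', hθK', hQ⟩ := K.exists_adjoin_root θ (X ^ n - C ⟨c, hc⟩)
    (monic_X_pow_sub_C _ hn.ne') (by simp [hθ, hmap])
    (fun x => (x ≠ 0 → ∃ γ ∈ Γ, w x = (γ : ℚ)) ∧ (0 ≤ w x → x ∈ B))
    (by
      intro g hg
      rw [degree_X_pow_sub_C hn] at hg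
      by_cases hg0 : g = 0
      · subst hg0
        simp
      have hgn : g.natDegree < n := (natDegree_lt_iff_degree_lt hg0).2 hg
      rw [aeval_eq_sum_range' hgn]
      simp only [Algebra.smul_def, hmap]
      have hval : ∀ i, (g.coeff i : L) * θ ^ i ≠ 0 → ∃ β ∈ Γ, w (g.coeff i) = (β : ℚ) :=
        fun i hi => (hK _ (g.coeff i).2).1 (left_ne_zero_of_mul hi)
      have hθ0 : θ ≠ 0 := by
        rintro rfl
        simp at hwθ
      have haux : ∀ i j : ℕ, i < j → j < n → ∀ x ∈ K, ∀ y ∈ K, x ≠ 0 →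
          w (x * θ ^ i) ≠ w (y * θ ^ j) := by
        intro i j hij hj x hx y hy hx0 h
        have hy0 : y ≠ 0 := by
          rintro rfl
          rw [zero_mul, w.map_zero, w.top_iff] at h
          exact mul_ne_zero hx0 (pow_ne_zero _ hθ0) h
        obtain ⟨a, -, ha⟩ := (hK x hx).1 hx0
        obtain ⟨b, -, hb⟩ := (hK y hy).1 hy0
        rw [hterm i x a ha, hterm j y b hb, WithTop.coe_inj] at h
        refine hmin (j - i) (by omega) (by omega) (x / y) (K.div_mem hx hy) ?_
        have hxy : w (x / y) = ((a - b : ℚ) : WithTop ℚ) := by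
          rw [w.map_div, ha, hb]
          norm_cast
        rw [hxy, WithTop.coe_inj, Nat.cast_sub hij.le]
        linarith
      obtain ⟨i, hi, hi0, hwi, hle⟩ := w.exists_map_sum_eq (Finset.range n)
        (fun i => (g.coeff i : L) * θ ^ i) (by
          intro i hi j hj hi0 h
          rw [Finset.mem_range] at hi hj
          obtain h1 | h1 | h1 := lt_trichotomy i j
          · exact absurd h (haux i j h1 hj _ (g.coeff i).2 _ (g.coeff j).2
              (left_ne_zero_of_mul hi0))
          · exact h1
          · have hj0 : (g.coeff j : L) * θ ^ j ≠ 0 := by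
              rw [← w.ne_top_iff, ← h, w.ne_top_iff]
              exact hi0
            exact absurd h.symm (haux j i h1 hi _ (g.coeff j).2 _ (g.coeff i).2
              (left_ne_zero_of_mul hj0)))
        ⟨g.natDegree, Finset.mem_range.2 hgn, mul_ne_zero (by simpa using hg0) (pow_ne_zero _ hθ0)⟩
      rw [hwi]
      refine ⟨fun _ => ?_, fun h0 => B.sum_mem fun j hj => ?_⟩
      · obtain ⟨β, hβ, hw⟩ := hval i hi0
        refine ⟨β + i * γ, Γ.add_mem hβ ?_, hterm i _ β hw⟩
        rw [← nsmul_eq_mul]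
        exact Γ.nsmul_mem hγ i
      · have h1 := h0.trans (hle j hj)
        obtain rfl | hj0 := Nat.eq_zero_or_pos j
        · rw [pow_zero, mul_one] at h1 ⊢
          exact (hK _ (g.coeff 0).2).2 h1
        · refine hB _ (lt_of_le_of_ne h1 fun h2 => ?_)
          exact haux 0 j hj0 (Finset.mem_range.1 hj) 1 K.one_mem _ (g.coeff j).2 one_ne_zero
            (by rw [← h2]; simp))
  exact ⟨K', hKK', hQ, θ, hθK', hwθ⟩

theorem AddValuation.exists_pos_of_prod_pos {L : Type*} [Field L] (w : AddValuation L (WithTop ℚ))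
    (s : Multiset L) (h : 0 < w s.prod) : ∃ x ∈ s, 0 < w x := by
  induction s using Multiset.induction with
  | empty => simp at h
  | cons a s ih =>
    by_cases ha : 0 < w a
    · exact ⟨a, by simp, ha⟩
    · rw [Multiset.prod_cons, w.map_mul] at h
      obtain ⟨x, hx, hw⟩ := ih (by
        by_contra hs
        exact absurd h (not_lt.2 (add_nonpos (not_lt.1 ha) (not_lt.1 hs))))
      exact ⟨x, by simp [hx], hw⟩

theorem AddValuation.aeval_nonneg {L : Type*} [Field L] (w : AddValuation L (WithTop ℚ))
    {K : Subfield L} {g : K[X]} (hg : ∀ i, 0 ≤ w (g.coeff i)) {x : L} (hx : 0 ≤ w x) :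
    0 ≤ w (aeval x g) := by
  rw [aeval_eq_sum_range]
  refine w.map_le_sum fun i _ => ?_
  rw [Algebra.smul_def, w.map_mul, w.map_pow]
  exact add_nonneg (hg i) (nsmul_nonneg hx i)

theorem AddValuation.aeval_sub_pos {L : Type*} [Field L] (w : AddValuation L (WithTop ℚ))
    {K : Subfield L} {g : K[X]} (hg : ∀ i, 0 ≤ w (g.coeff i)) {x y : L} (hx : 0 ≤ w x)
    (hy : 0 ≤ w y) (hxy : 0 < w (x - y)) : 0 < w (aeval x g - aeval y g) := by
  rw [aeval_eq_sum_range, aeval_eq_sum_range, ← Finset.sum_sub_distrib]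
  refine w.map_lt_sum WithTop.zero_ne_top fun i _ => ?_
  rw [← smul_sub, Algebra.smul_def, w.map_mul]
  refine lt_of_lt_of_le ?_ (le_add_of_nonneg_left (hg i))
  rw [← (Commute.all x y).mul_geom_sum₂, w.map_mul]
  refine lt_of_lt_of_le hxy (le_add_of_nonneg_right (w.map_le_sum fun j _ => ?_))
  rw [w.map_mul, w.map_pow, w.map_pow]
  exact add_nonneg (nsmul_nonneg hx _) (nsmul_nonneg hy _)

theorem AddValuation.not_aeval_pos_of_natDegree_lt {L : Type*} [Field L]
    (w : AddValuation L (WithTop ℚ)) {K : Subfield L} {r : L} (hr : 0 ≤ w r) {n : ℕ}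
    (hmin : ∀ f : K[X], f.Monic → (∀ i, 0 ≤ w (f.coeff i)) → f.natDegree < n →
      ¬ 0 < w (aeval r f)) (h : K[X]) (hint : ∀ i, 0 ≤ w (h.coeff i))
    (hunit : ∃ j, w (h.coeff j) = 0) (hdeg : h.natDegree < n) : ¬ 0 < w (aeval r h) := by
  intro hpos
  by_cases hlead : w (h.leadingCoeff : L) = 0
  · have h0 : h.leadingCoeff ≠ 0 := by
      intro h0
      rw [h0] at hlead
      simp at hlead
    have hinv : w ((h.leadingCoeff⁻¹ : K) : L) = 0 := by
      rw [Subfield.coe_inv, w.map_inv, hlead, neg_zero]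
    refine hmin (C h.leadingCoeff⁻¹ * h) ?_ (fun i => ?_) ?_ ?_
    · rw [mul_comm]
      exact monic_mul_leadingCoeff_inv (leadingCoeff_ne_zero.1 h0)
    · rw [coeff_C_mul, Subfield.coe_mul, w.map_mul, hinv, zero_add]
      exact hint i
    · rwa [natDegree_C_mul (inv_ne_zero h0)]
    · rw [_root_.map_mul, aeval_C, w.map_mul]
      exact hpos.trans_le (le_add_of_nonneg_left hinv.ge)
  · have hne : h ≠ 0 := by
      rintro rfl
      obtain ⟨j, hj⟩ := hunit
      simp at hj
    have hcoeff : ∀ i, i ≠ h.natDegree → h.eraseLead.coeff i = h.coeff i :=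
      fun i hi => eraseLead_coeff_of_ne i hi
    refine w.not_aeval_pos_of_natDegree_lt hr hmin h.eraseLead (fun i => ?_) ?_
      (lt_of_le_of_lt eraseLead_natDegree_le_aux hdeg) ?_
    · by_cases hi : i = h.natDegree
      · simp [hi]
      · rw [hcoeff i hi]
        exact hint i
    · obtain ⟨j, hj⟩ := hunit
      refine ⟨j, ?_⟩
      rwa [hcoeff j]
      rintro rfl
      exact hlead hj
    · have : aeval r h.eraseLead = aeval r h - (h.leadingCoeff : L) * r ^ h.natDegree := by
        rw [eq_sub_iff_add_eq]
        conv_rhs => rw [← h.eraseLead_add_C_mul_X_pow]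
        simp only [_root_.map_add, _root_.map_mul, aeval_C, _root_.map_pow, aeval_X]
        rfl
      rw [this]
      refine lt_of_lt_of_le (lt_min hpos ?_) (w.map_sub _ _)
      rw [w.map_mul, w.map_pow]
      exact add_pos_of_pos_of_nonneg (lt_of_le_of_ne (hint _) (Ne.symm hlead)) (nsmul_nonneg hr _)
termination_by h.support.card
decreasing_by exact eraseLead_support_card_lt hne

theorem IsBoundedBy.exists_residue {L : Type*} [Field L] [IsAlgClosed L]
    {w : AddValuation L (WithTop ℚ)} {Γ : AddSubgroup ℚ} {B : Subring L} {K : Subfield L}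
    (hK : IsBoundedBy w Γ B K) (hB : ∀ x, 0 < w x → x ∈ B) (hB' : ∀ x ∈ B, 0 ≤ w x)
    {r : L} (hr : r ∈ B)
    (hf : ∃ f : K[X], f.Monic ∧ (∀ i, 0 ≤ w (f.coeff i)) ∧ 0 < w (aeval r f)) :
    ∃ K' : Subfield L, K ≤ K' ∧ IsBoundedBy w Γ B K' ∧ ∃ x ∈ K', 0 < w (r - x) := by
  classical
  have hex : ∃ n : ℕ, ∃ f : K[X], f.natDegree = n ∧ f.Monic ∧ (∀ i, 0 ≤ w (f.coeff i)) ∧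
      0 < w (aeval r f) := by
    obtain ⟨f, hf⟩ := hf
    exact ⟨_, f, rfl, hf⟩
  obtain ⟨f, hfn, hfm, hfint, hfpos⟩ := Nat.find_spec hex
  have hmin : ∀ g : K[X], g.Monic → (∀ i, 0 ≤ w (g.coeff i)) → g.natDegree < Nat.find hex →
      ¬ 0 < w (aeval r g) := fun g hm hi hlt hpos => Nat.find_min hex hlt ⟨g, rfl, hm, hi, hpos⟩
  rw [← hfn] at hmin
  have hwr : 0 ≤ w r := hB' r hr
  obtain ⟨θ, hθ, hθr⟩ : ∃ θ : L, aeval θ f = 0 ∧ 0 < w (r - θ) := by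
    have hs := IsAlgClosed.splits (f.map (algebraMap K L))
    have he := hs.eval_eq_prod_roots_of_monic (hfm.map _) r
    rw [eval_map_algebraMap] at he
    rw [he] at hfpos
    obtain ⟨x, hx, hw⟩ := w.exists_pos_of_prod_pos _ hfpos
    obtain ⟨θ, hθ, rfl⟩ := Multiset.mem_map.1 hx
    refine ⟨θ, ?_, hw⟩
    have := isRoot_of_mem_roots hθ
    rwa [IsRoot.def, eval_map_algebraMap] at this
  have hθB : θ ∈ B := by
    have := B.sub_mem hr (hB _ hθr)
    rwa [sub_sub_cancel] at this
  have hmap : ∀ x : K, algebraMap K L x = x := fun _ => rfl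
  obtain ⟨K', hKK', hθK', hQ⟩ := K.exists_adjoin_root θ f hfm hθ
    (fun x => (x ≠ 0 → ∃ γ ∈ Γ, w x = (γ : ℚ)) ∧ (0 ≤ w x → x ∈ B)) (by
      intro g hg
      by_cases hg0 : g = 0
      · subst hg0
        simp
      have hgn : g.natDegree < f.natDegree := natDegree_lt_natDegree hg0 hg
      obtain ⟨j, hj, hjmin⟩ := g.support.exists_min_image (fun i => w (g.coeff i : L))
        (support_nonempty.2 hg0)
      have hjle : ∀ i, w (g.coeff j : L) ≤ w (g.coeff i : L) := by
        intro i
        by_cases hi : i ∈ g.support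
        · exact hjmin i hi
        · rw [notMem_support_iff.1 hi]
          simp
      have hb0 : g.coeff j ≠ 0 := mem_support_iff.1 hj
      obtain ⟨β, hβ, hwβ⟩ := (hK _ (g.coeff j).2).1 (by simpa using hb0)
      have hcoeff : ∀ i, w ((C (g.coeff j)⁻¹ * g).coeff i : L) =
          -((β : ℚ) : WithTop ℚ) + w (g.coeff i : L) := by
        intro i
        rw [coeff_C_mul, Subfield.coe_mul, w.map_mul, Subfield.coe_inv, w.map_inv, hwβ]
      have hβcancel : -((β : ℚ) : WithTop ℚ) + (β : ℚ) = 0 := by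
        norm_cast
        simp
      have hint : ∀ i, 0 ≤ w ((C (g.coeff j)⁻¹ * g).coeff i : L) := by
        intro i
        rw [hcoeff, ← hβcancel, ← hwβ]
        gcongr
        exact hjle i
      have hunit : ∃ i, w ((C (g.coeff j)⁻¹ * g).coeff i : L) = 0 :=
        ⟨j, by rw [hcoeff, hwβ, hβcancel]⟩
      have hnot := w.not_aeval_pos_of_natDegree_lt hwr hmin _ hint hunit
        (by rwa [natDegree_C_mul (inv_ne_zero hb0)])
      have hzero : w (aeval r (C (g.coeff j)⁻¹ * g)) = 0 :=
        le_antisymm (not_lt.1 hnot) (w.aeval_nonneg hint hwr)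
      have hzero' : w (aeval θ (C (g.coeff j)⁻¹ * g)) = 0 := by
        rw [← hzero]
        refine w.map_eq_of_lt_sub ?_
        rw [hzero, w.map_sub_swap]
        exact w.aeval_sub_pos hint hwr (hB' θ hθB) hθr
      have hval : w (aeval θ g) = (β : ℚ) := by
        have hg' : g = C (g.coeff j) * (C (g.coeff j)⁻¹ * g) := by
          rw [← mul_assoc, ← C_mul, mul_inv_cancel₀ hb0, C_1, one_mul]
        rw [hg', map_mul, w.map_mul, hzero', add_zero, aeval_C, hmap, hwβ]
      rw [hval]
      refine ⟨fun _ => ⟨β, hβ, rfl⟩, fun h0 => ?_⟩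
      rw [aeval_eq_sum_range]
      simp only [Algebra.smul_def, hmap]
      exact B.sum_mem fun i _ => B.mul_mem
        ((hK _ (g.coeff i).2).2 ((h0.trans hwβ.ge).trans (hjle i))) (B.pow_mem hθB i))
  exact ⟨K', hKK', hQ, θ, hθK', hθr⟩

theorem exists_subfield_value_residue {L : Type*} [Field L] [IsAlgClosed L] [CharZero L]
    (w : AddValuation L (WithTop ℚ)) (Γ : AddSubgroup ℚ) (hΓ : ∀ n : ℤ, (n : ℚ) ∈ Γ)
    (B : Subring L) (hB : ∀ x, 0 < w x → x ∈ B) (hB' : ∀ x ∈ B, 0 ≤ w x)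
    (hB'' : ∀ x ∈ B, ∃ m : ℕ, 2 ≤ m ∧ 0 < w (x ^ m - x))
    (hQ : ∀ q : ℚ, q ≠ 0 → ∃ n : ℤ, w (q : L) = ((n : ℚ) : WithTop ℚ))
    (hZ : ∀ n : ℤ, ∃ q : ℚ, w (q : L) = ((n : ℚ) : WithTop ℚ))
    (hres : ∀ q : ℚ, 0 ≤ w (q : L) → ∃ n : ℕ, 0 < w ((q : L) - n)) :
    ∃ K : Subfield L, IsBoundedBy w Γ B K ∧ (∀ γ ∈ Γ, ∃ x ∈ K, w x = (γ : ℚ)) ∧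
      ∀ x ∈ B, ∃ y ∈ K, 0 < w (x - y) := by
  have hbot : IsBoundedBy w Γ B ⊥ := by
    intro x hx
    rw [Subfield.bot_eq_of_charZero] at hx
    obtain ⟨q, rfl⟩ := hx
    rw [eq_ratCast]
    refine ⟨fun h => ?_, fun h => ?_⟩
    · obtain ⟨n, hn⟩ := hQ q (by simpa using h)
      exact ⟨n, hΓ n, hn⟩
    · obtain ⟨n, hn⟩ := hres q h
      have := B.add_mem (hB _ hn) (natCast_mem B n)
      rwa [sub_add_cancel] at this
  obtain ⟨K, -, hK⟩ := zorn_le_nonempty₀ {K : Subfield L | IsBoundedBy w Γ B K} (by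
    intro c hc hchain F hF
    refine ⟨sSup c, fun x hx => ?_, fun F hF => le_sSup hF⟩
    obtain ⟨F', hF', hx'⟩ := (Subfield.mem_sSup_of_directedOn ⟨F, hF⟩ hchain.directedOn).1 hx
    exact hc hF' x hx') ⊥ hbot
  have hrat : ∀ q : ℚ, (q : L) ∈ K := fun q => SubfieldClass.ratCast_mem K q
  refine ⟨K, hK.prop, fun γ hγ => ?_, fun r hr => ?_⟩
  · obtain ⟨K', hKK', hK', x, hx, hw⟩ := hK.prop.exists_value hB (fun n => by
      obtain ⟨q, hq⟩ := hZ n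
      exact ⟨q, hrat q, hq⟩) hγ
    exact ⟨x, hK.le_of_ge hK' hKK' hx, hw⟩
  · obtain ⟨m, hm, hw⟩ := hB'' r hr
    obtain ⟨K', hKK', hK', x, hx, hw⟩ := hK.prop.exists_residue hB hB' hr ⟨X ^ m - X,
      monic_X_pow_sub (by rw [degree_X]; exact_mod_cast hm), fun i => by
        rw [coeff_sub, coeff_X_pow, coeff_X, Subfield.coe_sub]
        refine w.map_le_sub ?_ ?_ <;> split_ifs <;> simp, by simpa using hw⟩
    exact ⟨x, hK.le_of_ge hK' hKK' hx, hw⟩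

/-- A hand-made Baire category argument: countably many conditions, each of which holds on balls
with centres arbitrarily close to any given point of `T`, hold simultaneously at a limit point
of `T`. -/
theorem exists_forall_of_dense_balls {C ι : Type*} [Field C] [Countable ι]
    (w : AddValuation C (WithTop ℚ))
    (hcomplete : ∀ s : ℕ → C,
      (∀ γ : ℚ, ∃ N : ℕ, ∀ m ≥ N, ∀ n ≥ N, (γ : WithTop ℚ) < w (s m - s n)) →
      ∃ l, ∀ γ : ℚ, ∃ N : ℕ, ∀ n ≥ N, (γ : WithTop ℚ) < w (s n - l))
    {T : Set C} (hT : T.Nonempty) (R : ι → C → Prop)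
    (hR : ∀ i, ∀ a ∈ T, ∀ N : ℕ, ∃ b ∈ T, ((N : ℚ) : WithTop ℚ) ≤ w (b - a) ∧
      ∃ M : ℕ, ∀ β, ((M : ℚ) : WithTop ℚ) ≤ w (β - b) → R i β) :
    ∃ α, (∀ N : ℕ, ∃ b ∈ T, ((N : ℚ) : WithTop ℚ) ≤ w (α - b)) ∧ ∀ i, R i α := by
  obtain ⟨a₀, ha₀⟩ := hT
  have hmono : ∀ {m n : ℕ}, m ≤ n → ((m : ℚ) : WithTop ℚ) ≤ ((n : ℚ) : WithTop ℚ) :=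
    fun h => by exact_mod_cast h
  have hstep : ∀ (i : Option ι) (x : T × ℕ), ∃ y : T × ℕ, x.2 < y.2 ∧
      ((x.2 : ℚ) : WithTop ℚ) ≤ w (y.1 - x.1 : C) ∧
      ∀ j ∈ i, ∀ β, ((y.2 : ℚ) : WithTop ℚ) ≤ w (β - y.1) → R j β := by
    rintro (_ | i) ⟨⟨a, ha⟩, N⟩
    · exact ⟨⟨⟨a, ha⟩, N + 1⟩, by simp, by simp, by simp⟩
    · obtain ⟨b, hb, hab, M, hM⟩ := hR i a ha N
      refine ⟨⟨⟨b, hb⟩, max M (N + 1)⟩, by simp, hab, ?_⟩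
      rintro j hj β hβ
      obtain rfl := Option.mem_some_iff.1 hj
      exact hM β ((hmono (le_max_left _ _)).trans hβ)
  choose next hlt hnear hnext using hstep
  obtain ⟨e, he⟩ := exists_surjective_nat (Option ι)
  let s : ℕ → T × ℕ := fun n => Nat.rec ⟨⟨a₀, ha₀⟩, 0⟩ (fun n x => next (e n) x) n
  have hs : ∀ n, s (n + 1) = next (e n) (s n) := fun n => rfl
  have hrad : StrictMono fun n => (s n).2 := strictMono_nat_of_lt_succ fun n => by
    rw [hs]
    exact hlt _ _
  have hball : ∀ n m, n ≤ m → (((s n).2 : ℚ) : WithTop ℚ) ≤ w ((s m).1 - (s n).1 : C) := by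
    intro n m hnm
    induction m, hnm using Nat.le_induction with
    | base => simp
    | succ m hnm ih =>
      have h1 := hnear (e m) (s m)
      rw [← hs] at h1
      have := w.map_le_add ((hmono (hrad.monotone hnm)).trans h1) ih
      rwa [sub_add_sub_cancel] at this
  obtain ⟨α, hα⟩ := hcomplete (fun n => (s n).1) (by
    intro γ
    obtain ⟨N, hN⟩ := exists_nat_gt γ
    have hN' : (γ : WithTop ℚ) < (((s N).2 : ℚ) : WithTop ℚ) :=
      lt_of_lt_of_le (by exact_mod_cast hN) (hmono (hrad.id_le N))
    refine ⟨N, fun m hm n hn => hN'.trans_le ?_⟩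
    have := w.map_le_sub (hball N m hm) (hball N n hn)
    rwa [sub_sub_sub_cancel_right] at this)
  have hlim : ∀ n, (((s n).2 : ℚ) : WithTop ℚ) ≤ w (α - (s n).1) := by
    intro n
    obtain ⟨N, hN⟩ := hα ((s n).2 : ℚ)
    have := w.map_le_sub (hball n (max n N) (le_max_left _ _)) (hN (max n N) (le_max_right _ _)).le
    rwa [sub_sub_sub_cancel_left] at this
  refine ⟨α, fun N => ⟨(s N).1, (s N).1.2, (hmono (hrad.id_le N)).trans (hlim N)⟩, fun i => ?_⟩
  obtain ⟨n, hn⟩ := he (some i)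
  refine hnext (e n) (s n) i (by rw [hn]; rfl) α ?_
  rw [← hs]
  exact hlim (n + 1)

theorem AddValuation.exists_lt_aeval_sub {C : Type*} [Field C] [Algebra ℚ C]
    (w : AddValuation C (WithTop ℚ)) (f : ℚ[X]) (b : C) (γ : ℚ) :
    ∃ M : ℕ, ∀ β, ((M : ℚ) : WithTop ℚ) ≤ w (β - b) → (γ : WithTop ℚ) < w (aeval β f - aeval b f) := by
  have hmono : ∀ {m n : ℕ}, m ≤ n → ((m : ℚ) : WithTop ℚ) ≤ ((n : ℚ) : WithTop ℚ) :=
    fun h => by exact_mod_cast h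
  have hbound : ∀ x : C, ∃ c : ℚ, c ≤ 0 ∧ (c : WithTop ℚ) ≤ w x := by
    intro x
    by_cases hx : w x = ⊤
    · exact ⟨0, le_rfl, by simp [hx]⟩
    · lift w x to ℚ using hx with t
      exact ⟨min t 0, min_le_right _ _, by exact_mod_cast min_le_left _ _⟩
  induction f using Polynomial.induction_on' generalizing γ with
  | add f g hf hg =>
    obtain ⟨M, hM⟩ := hf γ
    obtain ⟨N, hN⟩ := hg γ
    refine ⟨max M N, fun β hβ => ?_⟩
    have := w.map_lt_add (hM β ((hmono (le_max_left _ _)).trans hβ))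
      (hN β ((hmono (le_max_right _ _)).trans hβ))
    rwa [sub_add_sub_comm, ← _root_.map_add, ← _root_.map_add] at this
  | monomial n a =>
    obtain ⟨c, hc, hcb⟩ := hbound b
    obtain ⟨d, hd, hda⟩ := hbound (algebraMap ℚ C a)
    obtain ⟨M, hM⟩ := exists_nat_gt (γ - d - n * c)
    refine ⟨M, fun β hβ => ?_⟩
    have hcβ : (c : WithTop ℚ) ≤ w β := by
      have h1 : (c : WithTop ℚ) ≤ w (β - b) := le_trans (by
        have : c ≤ (M : ℚ) := hc.trans (Nat.cast_nonneg M)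
        exact_mod_cast this) hβ
      have := w.map_le_add h1 hcb
      rwa [sub_add_cancel] at this
    rw [aeval_monomial, aeval_monomial, ← mul_sub, w.map_mul, ← (Commute.all β b).mul_geom_sum₂,
      w.map_mul]
    have hsum : ((n * c : ℚ) : WithTop ℚ) ≤
        w (∑ i ∈ Finset.range n, β ^ i * b ^ (n - 1 - i)) := by
      refine w.map_le_sum fun i hi => ?_
      rw [Finset.mem_range] at hi
      rw [w.map_mul, w.map_pow, w.map_pow]
      have h1 : (((i • c : ℚ)) : WithTop ℚ) ≤ i • w β := by
        rw [WithTop.coe_nsmul]; exact nsmul_le_nsmul_right hcβ i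
      have h2 : ((((n - 1 - i) • c : ℚ)) : WithTop ℚ) ≤ (n - 1 - i) • w b := by
        rw [WithTop.coe_nsmul]; exact nsmul_le_nsmul_right hcb _
      refine le_trans ?_ (add_le_add h1 h2)
      rw [← WithTop.coe_add, WithTop.coe_le_coe, ← add_nsmul, nsmul_eq_mul]
      exact mul_le_mul_of_nonpos_right (by exact_mod_cast (by omega)) hc
    refine lt_of_lt_of_le ?_ (add_le_add hda (add_le_add hβ hsum))
    rw [← WithTop.coe_add, ← WithTop.coe_add, WithTop.coe_lt_coe]
    linarith

theorem exists_add_natPow_mul_aeval_eq {F C : Type*} [Field F] [CharZero F] [Field C]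
    [Algebra F C] {a x : C}
    (ha : IsAlgebraic F a) (hx : IsAlgebraic F x) {c : F}
    (hc : Function.Injective fun n : ℕ => c ^ n) (N : ℕ) :
    ∃ n ≥ N, ∃ f : F[X], aeval (a + algebraMap F C c ^ n * x) f = x := by
  let E : IntermediateField F C := IntermediateField.adjoin F {a, x}
  have haE : a ∈ E := IntermediateField.subset_adjoin _ _ (by simp)
  have hxE : x ∈ E := IntermediateField.subset_adjoin _ _ (by simp)
  have : FiniteDimensional F E := by
    refine IntermediateField.finiteDimensional_adjoin ?_
    rintro y (rfl | rfl)
    · exact ha.isIntegral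
    · exact hx.isIntegral
  have : Finite (IntermediateField F E) :=
    Field.finite_intermediateField_of_exists_primitive_element F E (Field.exists_primitive_element F E)
  let z : ℕ → E := fun n => ⟨a, haE⟩ + algebraMap F E (c ^ (N + n)) * ⟨x, hxE⟩
  obtain ⟨m, n, hmn, h⟩ := Finite.exists_ne_map_eq_of_infinite
    (fun n => IntermediateField.adjoin F {z n})
  have hxm : (⟨x, hxE⟩ : E) ∈ IntermediateField.adjoin F {z m} := by
    have hm := IntermediateField.mem_adjoin_simple_self F (z m)
    have hn := IntermediateField.mem_adjoin_simple_self F (z n)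
    rw [← show IntermediateField.adjoin F {z m} = IntermediateField.adjoin F {z n} from h] at hn
    have hne : c ^ (N + m) - c ^ (N + n) ≠ 0 := by
      rw [sub_ne_zero]
      intro h
      have := hc h
      omega
    have hdiff := IntermediateField.smul_mem _ (sub_mem hm hn) (x := (c ^ (N + m) - c ^ (N + n))⁻¹)
    convert hdiff using 1
    simp only [z, Algebra.smul_def]
    rw [add_sub_add_left_eq_sub, ← sub_mul, ← map_sub, ← mul_assoc, ← map_mul,
      inv_mul_cancel₀ hne, map_one, one_mul]
  have hint : IsAlgebraic F (z m) := Algebra.IsAlgebraic.isAlgebraic _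
  rw [← IntermediateField.mem_toSubalgebra,
    IntermediateField.adjoin_simple_toSubalgebra_of_isAlgebraic hint,
    Algebra.adjoin_singleton_eq_range_aeval] at hxm
  obtain ⟨f, hf⟩ := hxm
  refine ⟨N + m, by omega, f, ?_⟩
  have := congrArg (algebraMap E C) hf
  rw [AlgHom.toRingHom_eq_coe, RingHom.coe_coe, ← aeval_algebraMap_apply] at this
  simpa [z] using this

theorem AddValuation.exists_transcendental_limit {C : Type*} [Field C] [Algebra ℚ C]
    (w : AddValuation C (WithTop ℚ))
    (hcomplete : ∀ s : ℕ → C,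
      (∀ γ : ℚ, ∃ N : ℕ, ∀ m ≥ N, ∀ n ≥ N, (γ : WithTop ℚ) < w (s m - s n)) →
      ∃ l, ∀ γ : ℚ, ∃ N : ℕ, ∀ n ≥ N, (γ : WithTop ℚ) < w (s n - l))
    (K : Subfield C) [Countable K] (halg : ∀ x ∈ K, IsAlgebraic ℚ x)
    {c : ℚ} (hc : 1 < c) (hwc : w (algebraMap ℚ C c) = ((1 : ℚ) : WithTop ℚ)) :
    ∃ α, Transcendental ℚ α ∧ (∀ N : ℕ, ∃ b ∈ K, ((N : ℚ) : WithTop ℚ) ≤ w (α - b)) ∧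
      ∀ x ∈ K, ∀ N : ℕ, ∃ f : ℚ[X], ((N : ℚ) : WithTop ℚ) < w (aeval α f - x) := by
  classical
  have hinj : Function.Injective fun n : ℕ => c ^ n :=
    pow_right_injective₀ (zero_lt_one.trans hc) hc.ne'
  have hcK : ∀ n : ℕ, algebraMap ℚ C c ^ n ∈ K := fun n => K.pow_mem (by
    rw [eq_ratCast]
    exact SubfieldClass.ratCast_mem K c) n
  have hwpow : ∀ n : ℕ, w (algebraMap ℚ C c ^ n) = ((n : ℚ) : WithTop ℚ) := by
    intro n
    rw [w.map_pow, hwc, ← WithTop.coe_nsmul, nsmul_eq_mul, mul_one]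
  have : Countable ℚ[X] := by
    rw [← Cardinal.mk_le_aleph0_iff]
    exact Polynomial.cardinalMk_le_max.trans (by simp)
  obtain ⟨α, hα, hR⟩ := exists_forall_of_dense_balls w hcomplete (T := (K : Set C)) ⟨0, K.zero_mem⟩
    (Sum.elim (fun (i : K × ℕ) β => ∃ f : ℚ[X], ((i.2 : ℚ) : WithTop ℚ) < w (aeval β f - i.1))
      (fun (f : {f : ℚ[X] // f ≠ 0}) β => aeval β f.1 ≠ 0)) (by
    rintro (⟨⟨x, hx⟩, n⟩ | ⟨f, hf⟩) a ha N
    · obtain ⟨N', hN'⟩ : ∃ N' : ℕ, ((N : ℚ) : WithTop ℚ) ≤ ((N' : ℚ) : WithTop ℚ) + w x := by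
        by_cases h : w x = ⊤
        · exact ⟨0, by simp [h]⟩
        · lift w x to ℚ using h with t
          obtain ⟨N', hN'⟩ := exists_nat_ge (N - t)
          refine ⟨N', ?_⟩
          rw [← WithTop.coe_add, WithTop.coe_le_coe]
          linarith
      obtain ⟨m, hm, f, hf⟩ := exists_add_natPow_mul_aeval_eq (halg a ha) (halg x hx) hinj N'
      obtain ⟨M, hM⟩ := w.exists_lt_aeval_sub f (a + algebraMap ℚ C c ^ m * x) n
      refine ⟨_, K.add_mem ha (K.mul_mem (hcK m) hx), ?_, M, fun β hβ => ⟨f, ?_⟩⟩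
      · rw [add_sub_cancel_left, w.map_mul, hwpow]
        refine hN'.trans ?_
        gcongr
        exact_mod_cast hm
      · simpa only [hf] using hM β hβ
    · have hfin : {n : ℕ | aeval (a + algebraMap ℚ C c ^ n) f = 0}.Finite := by
        refine Set.Finite.preimage (f := fun n : ℕ => a + algebraMap ℚ C c ^ n)
          (s := {x | aeval x f = 0}) (fun m _ n _ h => ?_) ?_
        · rw [add_right_inj, ← _root_.map_pow, ← _root_.map_pow] at h
          exact hinj ((algebraMap ℚ C).injective h)
        · refine (f.aroots C).toFinset.finite_toSet.subset fun x hx => ?_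
          simpa [mem_aroots, hf] using hx
      obtain ⟨m, hm, hNm⟩ := hfin.infinite_compl.exists_gt N
      set b := a + algebraMap ℚ C c ^ m
      have hb : aeval b f ≠ 0 := hm
      obtain ⟨t, ht⟩ := WithTop.ne_top_iff_exists.1 (w.ne_top_iff.2 hb)
      obtain ⟨M, hM⟩ := w.exists_lt_aeval_sub f b t
      refine ⟨b, K.add_mem ha (hcK m), ?_, M, fun β hβ h0 => ?_⟩
      · rw [add_sub_cancel_left, hwpow]
        exact_mod_cast hNm.le
      · have := hM β hβ
        simp only at h0
        rw [h0, zero_sub, w.map_neg, ht] at this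
        exact lt_irrefl _ this)
  refine ⟨α, ?_, hα, fun x hx N => hR (Sum.inl (⟨x, hx⟩, N))⟩
  rintro ⟨f, hf, h0⟩
  exact hR (Sum.inr ⟨f, hf⟩) h0

theorem AddValuation.exists_mem_lt_div_sub {C : Type*} [Field C] [Algebra ℚ C]
    (w : AddValuation C (WithTop ℚ)) (K : Subfield C) {α : C}
    (hα : ∀ N : ℕ, ∃ b ∈ K, ((N : ℚ) : WithTop ℚ) ≤ w (α - b)) (f : ℚ[X]) {g : ℚ[X]}
    (hg : aeval α g ≠ 0) (γ : ℚ) :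
    ∃ y ∈ K, (γ : WithTop ℚ) < w (aeval α f / aeval α g - y) := by
  have hmono : ∀ {m n : ℕ}, m ≤ n → ((m : ℚ) : WithTop ℚ) ≤ ((n : ℚ) : WithTop ℚ) :=
    fun h => by exact_mod_cast h
  obtain ⟨t, ht⟩ := WithTop.ne_top_iff_exists.1 (w.ne_top_iff.2 hg)
  obtain ⟨s, hs⟩ : ∃ s : ℚ, (s : WithTop ℚ) ≤ w (aeval α f) := by
    by_cases h : w (aeval α f) = ⊤
    · exact ⟨0, by simp [h]⟩
    · obtain ⟨s, hs⟩ := WithTop.ne_top_iff_exists.1 h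
      exact ⟨s, hs.le⟩
  obtain ⟨M₁, h₁⟩ := w.exists_lt_aeval_sub f α (γ + t)
  obtain ⟨M₂, h₂⟩ := w.exists_lt_aeval_sub g α (max t (γ + 2 * t - s))
  obtain ⟨b, hb, hw⟩ := hα (max M₁ M₂)
  rw [w.map_sub_swap] at hw
  have hf' := h₁ b ((hmono (le_max_left _ _)).trans hw)
  have hg' := h₂ b ((hmono (le_max_right _ _)).trans hw)
  have hgb : w (aeval b g) = (t : WithTop ℚ) := by
    rw [ht]
    refine w.map_eq_of_lt_sub ?_
    rw [← ht]
    refine lt_of_le_of_lt ?_ hg'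
    exact_mod_cast le_max_left _ _
  have hgb0 : aeval b g ≠ 0 := by
    rw [← w.ne_top_iff, hgb]
    exact WithTop.coe_ne_top
  have hmem : ∀ h : ℚ[X], aeval b h ∈ K := by
    intro h
    rw [aeval_eq_sum_range]
    refine K.sum_mem fun i _ => ?_
    rw [Algebra.smul_def, eq_ratCast]
    exact K.mul_mem (SubfieldClass.ratCast_mem K _) (K.pow_mem hb i)
  refine ⟨aeval b f / aeval b g, K.div_mem (hmem f) (hmem g), ?_⟩
  have hid : aeval α f / aeval α g - aeval b f / aeval b g =
      (aeval α f * (aeval b g - aeval α g) - (aeval b f - aeval α f) * aeval α g) /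
        (aeval α g * aeval b g) := by
    field_simp
    ring
  have hnum : ((γ + 2 * t : ℚ) : WithTop ℚ) < w (aeval α f * (aeval b g - aeval α g) -
      (aeval b f - aeval α f) * aeval α g) := by
    refine lt_of_lt_of_le (lt_min ?_ ?_) (w.map_sub _ _)
    · rw [w.map_mul]
      refine lt_of_le_of_lt ?_ (WithTop.add_lt_add_of_le_of_lt WithTop.coe_ne_top hs hg')
      rw [← WithTop.coe_add, WithTop.coe_le_coe]
      linarith [le_max_right t (γ + 2 * t - s)]
    · rw [w.map_mul, ← ht]
      refine lt_of_le_of_lt ?_ (WithTop.add_lt_add_right WithTop.coe_ne_top hf')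
      rw [← WithTop.coe_add, WithTop.coe_le_coe]
      linarith
  rw [hid]
  have hden : w (aeval α g * aeval b g) = ((2 * t : ℚ) : WithTop ℚ) := by
    rw [w.map_mul, ← ht, hgb, ← WithTop.coe_add, two_mul]
  generalize aeval α f * (aeval b g - aeval α g) - (aeval b f - aeval α f) * aeval α g = u at hnum
  have hu : w u = w (u / (aeval α g * aeval b g)) + ((2 * t : ℚ) : WithTop ℚ) := by
    rw [← hden, ← w.map_mul, div_mul_cancel₀ _ (mul_ne_zero hg hgb0)]
  rw [hu, WithTop.coe_add] at hnum
  exact lt_of_add_lt_add_right hnum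

theorem AddValuation.pow_sub_pos_congr {C : Type*} [Field C] (w : AddValuation C (WithTop ℚ))
    {x y : C} (hx : 0 ≤ w x) (hxy : 0 < w (x - y)) (n : ℕ) :
    0 < w (x ^ n - x) ↔ 0 < w (y ^ n - y) := by
  have hy : 0 ≤ w y := by
    have := w.map_le_sub hx hxy.le
    rwa [sub_sub_cancel] at this
  have hpow : 0 < w (x ^ n - y ^ n) := by
    rw [← (Commute.all x y).mul_geom_sum₂, w.map_mul]
    refine lt_of_lt_of_le hxy (le_add_of_nonneg_right (w.map_le_sum fun j _ => ?_))
    rw [w.map_mul, w.map_pow, w.map_pow]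
    exact add_nonneg (nsmul_nonneg hx _) (nsmul_nonneg hy _)
  have hdiff : 0 < w ((x ^ n - x) - (y ^ n - y)) := by
    rw [sub_sub_sub_comm]
    exact (lt_min hpow hxy).trans_le (w.map_sub _ _)
  constructor <;> intro h
  · have := (lt_min h hdiff).trans_le (w.map_sub _ _)
    rwa [sub_sub_cancel] at this
  · have := w.map_lt_add hdiff h
    rwa [sub_add_cancel] at this

/-- Inside a field `C` containing the algebraic numbers, there is a countable field of algebraic
numbers whose value group is `Γ` and whose residue field is isomorphic to `k`. -/
theorem exists_algebraic_subfield {C : Type} [Field C] [CharZero C] [Algebra ℚ C]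
    (w : AddValuation C (WithTop ℚ))
    (σ : AlgebraicClosure ℚ →+* C) {p : ℕ} (hprime : p.Prime) (hp : 0 < w (p : C))
    (hQ : ∀ q : ℚ, q ≠ 0 → ∃ n : ℤ, w (q : C) = ((n : ℚ) : WithTop ℚ))
    (hZ : ∀ n : ℤ, ∃ q : ℚ, w (q : C) = ((n : ℚ) : WithTop ℚ))
    (hres : ∀ q : ℚ, 0 ≤ w (q : C) → ∃ n : ℕ, 0 < w ((q : C) - n))
    (k : Type) [Field k] (hchar : (p : k) = 0)
    (halg : ∀ x : k, ∃ m : ℕ, 1 ≤ m ∧ x ^ p ^ m = x)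
    (Γ : AddSubgroup ℚ) (hΓ : ∀ n : ℤ, (n : ℚ) ∈ Γ) :
    ∃ K : Subfield C, Countable K ∧ (∀ x ∈ K, IsAlgebraic ℚ x) ∧
      (∀ x ∈ K, x ≠ 0 → ∃ γ ∈ Γ, w x = (γ : ℚ)) ∧ (∀ γ ∈ Γ, ∃ x ∈ K, w x = (γ : ℚ)) ∧
      (∀ x ∈ K, 0 ≤ w x → ∃ y : k, ∀ e : ℕ, 0 < w (x ^ p ^ e - x) ↔ y ^ p ^ e = y) ∧
      ∀ y : k, ∃ x ∈ K, 0 ≤ w x ∧ ∀ e : ℕ, 0 < w (x ^ p ^ e - x) ↔ y ^ p ^ e = y := by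
  have hσ : ∀ x, w.comap σ x = w (σ x) := fun _ => rfl
  have halgebraic : Algebra.IsAlgebraic ℚ (AlgebraicClosure ℚ) := AlgebraicClosure.isAlgebraic ℚ
  obtain ⟨B, hB', hB, hBk, hkB⟩ := exists_residue_subring (w.comap σ) hprime
    (by simpa [hσ] using hp) k hchar halg
  obtain ⟨K, hK, hKΓ, hKB⟩ := exists_subfield_value_residue (w.comap σ) Γ hΓ B hB hB' (by
      intro x hx
      obtain ⟨y, hy⟩ := hBk x hx
      obtain ⟨m, hm, hym⟩ := halg y
      exact ⟨p ^ m, hprime.two_le.trans (Nat.le_self_pow (by omega) p), (hy m).2 hym⟩)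
    (by simpa [hσ] using hQ) (by simpa [hσ] using hZ) (by simpa [hσ] using hres)
  refine ⟨K.map σ, ?_, ?_, ?_, fun γ hγ => ?_, ?_, fun y => ?_⟩
  · have : Countable (AlgebraicClosure ℚ) := by
      rw [← Cardinal.mk_le_aleph0_iff]
      exact (Algebra.IsAlgebraic.cardinalMk_le_max ℚ _).trans (by simp)
    have : (K.map σ : Set C).Countable := by
      rw [Subfield.coe_map]
      exact (Set.to_countable _).image _
    exact this.to_subtype
  · rintro _ ⟨x, -, rfl⟩
    obtain ⟨f, hf, hx⟩ := Algebra.IsAlgebraic.isAlgebraic (R := ℚ) x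
    refine ⟨f, hf, ?_⟩
    rw [aeval_def, ← RingHom.ext_rat (σ.comp (algebraMap ℚ _)) (algebraMap ℚ C), ← hom_eval₂,
      ← aeval_def, hx, map_zero]
  · rintro _ ⟨x, hx, rfl⟩ h0
    exact (hK x hx).1 (by rintro rfl; simp at h0)
  · obtain ⟨x, hx, h⟩ := hKΓ γ hγ
    exact ⟨σ x, ⟨x, hx, rfl⟩, h⟩
  · rintro _ ⟨x, hx, rfl⟩ h0
    obtain ⟨y, hy⟩ := hBk x ((hK x hx).2 h0)
    exact ⟨y, fun e => by simpa [hσ] using hy e⟩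
  · obtain ⟨x, hx, h⟩ := hkB y
    obtain ⟨z, hz, hxz⟩ := hKB x hx
    have h0 := hB' x hx
    refine ⟨σ z, ⟨z, hz, rfl⟩, ?_, fun e => ?_⟩
    · have := (w.comap σ).map_le_sub h0 hxz.le
      rwa [sub_sub_cancel] at this
    · rw [← h e, (w.comap σ).pow_sub_pos_congr h0 hxz]
      simp [hσ]

/-- The additive valuation of Mathlib given by an `AddVal`. -/
def AddVal.toAddValuation {K : Type} [Field K] (w : AddVal K) : AddValuation K (WithTop ℚ) :=
  AddValuation.of w.v ((w.v_eq_top_iff 0).2 rfl) (by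
    have h : w.v 1 ≠ ⊤ := fun h => one_ne_zero ((w.v_eq_top_iff 1).1 h)
    have h1 := w.v_mul 1 1
    rw [mul_one] at h1
    lift w.v 1 to ℚ using h with t
    norm_cast at h1 ⊢
    linarith) w.min_le_v_add w.v_mul

theorem AddVal.toAddValuation_apply {K : Type} [Field K] (w : AddVal K) (x : K) :
    w.toAddValuation x = w.v x := rfl

theorem CpSetup.charZero_Cp {p : ℕ} [Fact p.Prime] (S : CpSetup p) : CharZero S.Cp :=
  charZero_of_injective_ringHom S.emb.injective

theorem CpSetup.toAddValuation_ratCast {p : ℕ} [Fact p.Prime] (S : CpSetup p) {q : ℚ}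
    (hq : q ≠ 0) :
    S.vC.toAddValuation (qHomC p S q) = (((q : ℚ_[p]).valuation : ℚ) : WithTop ℚ) := by
  rw [AddVal.toAddValuation_apply, qHomC, qpHomC, RingHom.comp_apply, RingHom.comp_apply, S.vC_emb]
  exact S.vbar_extends _ (by simpa using hq)

theorem Padic.exists_natCast_valuation_sub_pos {p : ℕ} [Fact p.Prime] {q : ℚ}
    (hq : 0 ≤ (q : ℚ_[p]).valuation) :
    ∃ n : ℕ, q ≠ n → 0 < ((q - n : ℚ) : ℚ_[p]).valuation := by
  obtain ⟨x, hx⟩ : ∃ x : ℤ_[p], (x : ℚ_[p]) = q :=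
    ⟨⟨q, (Padic.norm_le_one_iff_val_nonneg _).2 hq⟩, rfl⟩
  obtain ⟨n, -, hn⟩ := PadicInt.exists_mem_range x
  refine ⟨n, fun hne => ?_⟩
  rw [IsLocalRing.mem_maximalIdeal, PadicInt.mem_nonunits, PadicInt.norm_def] at hn
  have hn' : ‖((q - n : ℚ) : ℚ_[p])‖ < 1 := by
    rw [Rat.cast_sub, Rat.cast_natCast]
    rwa [PadicInt.coe_sub, PadicInt.coe_natCast, hx] at hn
  have h0 : ((q - n : ℚ) : ℚ_[p]) ≠ 0 := by
    rw [Rat.cast_ne_zero]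
    exact sub_ne_zero.2 hne
  rw [Padic.norm_eq_zpow_neg_valuation h0] at hn'
  have hp : (1 : ℝ) < p := by exact_mod_cast (Fact.out : p.Prime).one_lt
  rw [zpow_lt_one_iff_right₀ hp] at hn'
  omega

theorem CpSetup.exists_algebraic_subfield {p : ℕ} [Fact p.Prime] (S : CpSetup p)
    [CharZero S.Cp] (k : Type) [Field k] (hchar : (p : k) = 0)
    (halg : ∀ x : k, ∃ m : ℕ, 1 ≤ m ∧ x ^ p ^ m = x)
    (Γ : AddSubgroup ℚ) (hΓ : ∀ n : ℤ, (n : ℚ) ∈ Γ) :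
    ∃ K : Subfield S.Cp, Countable K ∧ (∀ x ∈ K, IsAlgebraic ℚ x) ∧
      (∀ x ∈ K, x ≠ 0 → ∃ γ ∈ Γ, S.vC.toAddValuation x = (γ : ℚ)) ∧
      (∀ γ ∈ Γ, ∃ x ∈ K, S.vC.toAddValuation x = (γ : ℚ)) ∧
      (∀ x ∈ K, 0 ≤ S.vC.toAddValuation x →
        ∃ y : k, ∀ e : ℕ, 0 < S.vC.toAddValuation (x ^ p ^ e - x) ↔ y ^ p ^ e = y) ∧
      ∀ y : k, ∃ x ∈ K, 0 ≤ S.vC.toAddValuation x ∧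
        ∀ e : ℕ, 0 < S.vC.toAddValuation (x ^ p ^ e - x) ↔ y ^ p ^ e = y := by
  have hprime : p.Prime := Fact.out
  have : Algebra.IsAlgebraic ℚ (AlgebraicClosure ℚ) := AlgebraicClosure.isAlgebraic ℚ
  have hval : ∀ q : ℚ, q ≠ 0 →
      S.vC.toAddValuation (q : S.Cp) = (((q : ℚ_[p]).valuation : ℚ) : WithTop ℚ) := by
    intro q hq
    rw [← S.toAddValuation_ratCast hq, eq_ratCast]
  refine _root_.exists_algebraic_subfield S.vC.toAddValuation
    (S.emb.comp (IsAlgClosed.lift : AlgebraicClosure ℚ →ₐ[ℚ] Qpbar p).toRingHom) hprime ?_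
    (fun q hq => ⟨_, hval q hq⟩) (fun n => ⟨(p : ℚ) ^ n, ?_⟩) (fun q hq => ?_) k hchar halg Γ hΓ
  · have := hval p (by exact_mod_cast hprime.ne_zero)
    rw [Rat.cast_natCast] at this
    rw [this]
    simp
  · rw [hval _ (zpow_ne_zero _ (by exact_mod_cast hprime.ne_zero))]
    simp
  · by_cases h0 : q = 0
    · exact ⟨0, by simp [h0]⟩
    rw [hval q h0] at hq
    obtain ⟨n, hn⟩ := Padic.exists_natCast_valuation_sub_pos (p := p) (q := q)
      (by exact_mod_cast hq)
    refine ⟨n, ?_⟩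
    by_cases hqn : q = n
    · simp [hqn]
    · have := hval (q - n) (sub_ne_zero.2 hqn)
      rw [Rat.cast_sub, Rat.cast_natCast] at this
      rw [this]
      exact_mod_cast hn hqn

/-- Let `k` be an algebraic extension of `𝔽_p` and `Γ` a subgroup of `ℚ`
with `ℤ ⊆ Γ ⊆ ℚ`.  Then there exists `α ∈ ℂ_p`, transcendental over `ℚ`, such that the
valuation ring `ℤ_{(p),α}` of `ℚ(X)` has residue field isomorphic to `k` and value group
equal to `Γ`. -/
theorem stmt_15 (p : ℕ) [Fact p.Prime] (S : CpSetup p)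
    (k : Type) [Field k] (hchar : (p : k) = 0)
    (halg : ∀ x : k, ∃ m : ℕ, 1 ≤ m ∧ x ^ p ^ m = x)
    (Γ : AddSubgroup ℚ) (hZΓ : ∀ n : ℤ, (n : ℚ) ∈ Γ) :
    ∃ α : S.Cp, IsTranscOver (qHomC p S) α ∧
      -- the value group of `ℤ_{(p),α}` equals `Γ`
      ({γ : ℚ | ∃ φ : RatFunc ℚ,
          S.vC.v (RatFunc.eval (qHomC p S) α φ) = (γ : WithTop ℚ)} = (Γ : Set ℚ)) ∧
      -- the residue field of `ℤ_{(p),α}` is isomorphic to `k`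
      (∀ d : ℕ, 1 ≤ d → (FieldHasDeg p d k ↔ ZplaResHasDeg p S α d)) := by
  have := S.charZero_Cp
  have hprime : p.Prime := Fact.out
  obtain ⟨K, hKc, hKalg, hKval, hΓK, hKk, hkK⟩ := S.exists_algebraic_subfield k hchar halg Γ hZΓ
  set w := S.vC.toAddValuation
  have hv : ∀ x, S.vC.v x = w x := fun _ => rfl
  have hq : qHomC p S = algebraMap ℚ S.Cp := Subsingleton.elim _ _
  obtain ⟨α, htr, hαK, hKα⟩ := w.exists_transcendental_limit S.complete K hKalg (c := p)
    (by exact_mod_cast hprime.one_lt) (by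
      rw [← hq, S.toAddValuation_ratCast (by exact_mod_cast hprime.ne_zero)]
      simp)
  have hne : ∀ f : ℚ[X], f ≠ 0 → aeval α f ≠ 0 := fun f hf h => htr ⟨f, hf, h⟩
  have heval : ∀ φ : RatFunc ℚ, φ.eval (qHomC p S) α = aeval α φ.num / aeval α φ.denom := by
    intro φ
    rw [hq]
    rfl
  have hdenom : ∀ φ : RatFunc ℚ, aeval α φ.denom ≠ 0 := fun φ => hne _ φ.denom_ne_zero
  have hpoly : ∀ f : ℚ[X], (algebraMap ℚ[X] (RatFunc ℚ) f).eval (qHomC p S) α = aeval α f := by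
    intro f
    rw [RatFunc.eval_algebraMap, hq]
    rfl
  have happrox : ∀ (φ : RatFunc ℚ) (γ : ℚ),
      ∃ y ∈ K, (γ : WithTop ℚ) < w (φ.eval (qHomC p S) α - y) := by
    intro φ γ
    rw [heval]
    exact w.exists_mem_lt_div_sub K hαK _ (hdenom φ) γ
  have hmem : ∀ φ : RatFunc ℚ, φ ∈ Zpla p S α ↔ 0 ≤ w (φ.eval (qHomC p S) α) := by
    intro φ
    refine and_iff_right ?_
    rw [hq]
    exact hdenom φ
  refine ⟨α, ?_, ?_, fun d hd => ⟨?_, ?_⟩⟩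
  · intro f hf
    rw [hq]
    exact hne f hf
  · ext γ
    simp only [Set.mem_ofPred_eq, SetLike.mem_coe, hv]
    constructor
    · rintro ⟨φ, hφ⟩
      obtain ⟨y, hy, hlt⟩ := happrox φ γ
      have hwy : w y = (γ : WithTop ℚ) := by
        rw [← hφ]
        refine w.map_eq_of_lt_sub ?_
        rwa [hφ, w.map_sub_swap]
      obtain ⟨γ', hγ', h⟩ := hKval y hy (by
        rw [← w.ne_top_iff, hwy]
        exact WithTop.coe_ne_top)
      rw [hwy, WithTop.coe_inj] at h
      rwa [h]
    · intro hγ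
      obtain ⟨x, hx, hwx⟩ := hΓK γ hγ
      obtain ⟨N, hN⟩ := exists_nat_gt γ
      obtain ⟨f, hf⟩ := hKα x hx N
      refine ⟨algebraMap ℚ[X] (RatFunc ℚ) f, ?_⟩
      rw [hpoly, ← hwx]
      refine w.map_eq_of_lt_sub (lt_trans ?_ hf)
      rw [hwx]
      exact_mod_cast hN
  · rintro ⟨y, hy, hyd⟩
    obtain ⟨x, hx, hx0, hxy⟩ := hkK y
    obtain ⟨f, hf⟩ := hKα x hx 0
    rw [Nat.cast_zero, WithTop.coe_zero, w.map_sub_swap] at hf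
    have hfy : ∀ e : ℕ, 0 < w (aeval α f ^ p ^ e - aeval α f) ↔ y ^ p ^ e = y := fun e => by
      rw [← hxy e, w.pow_sub_pos_congr hx0 hf]
    refine ⟨algebraMap ℚ[X] (RatFunc ℚ) f, ?_, ?_, fun e he hed => ?_⟩
    · rw [hmem, hpoly]
      have := w.map_le_sub hx0 hf.le
      rwa [sub_sub_cancel] at this
    · rw [hpoly, hv, hfy]
      exact hy
    · rw [hpoly, hv, hfy]
      exact hyd e he hed
  · rintro ⟨φ, hφ, hφd, hφe⟩
    rw [hmem] at hφ
    obtain ⟨x, hx, hlt⟩ := happrox φ 0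
    rw [WithTop.coe_zero] at hlt
    have hx0 : 0 ≤ w x := by
      have := w.map_le_sub hφ hlt.le
      rwa [sub_sub_cancel] at this
    obtain ⟨y, hy⟩ := hKk x hx hx0
    refine ⟨y, ?_, fun e he hed h => hφe e he hed ?_⟩
    · rw [← hy, ← w.pow_sub_pos_congr hφ hlt]
      exact hφd
    · rw [hv, w.pow_sub_pos_congr hφ hlt, hy]
      exact h

end
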